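/- arXiv:1703.06114 — 6 statements merged into one kernel-verified Lean document; each statement's English description precedes it below -/
import Mathlib

section
/- Let 𝔛 be a countable type. For every function f from the finite subsets of 𝔛 to the real numbers, there exist functions φ : 𝔛 → ℝ and ρ : ℝ → ℝ such that for every finite subset S of 𝔛 one has f(S) = ρ(∑_{x ∈ S} φ(x)). -/
/-- **DeepSets, Theorem 2 (countable case).** Every function on finite subsets of a
countable universe decomposes as `ρ` applied to a sum of per-element features `φ`. -/
theorem deepsets_countable_decomposition {𝔛 : Type*} [Countable 𝔛]
    (f : Finset 𝔛 → ℝ) :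
    ∃ (φ : 𝔛 → ℝ) (ρ : ℝ → ℝ), ∀ S : Finset 𝔛, f S = ρ (∑ x ∈ S, φ x) := by
  obtain ⟨e, he⟩ := exists_injective_nat 𝔛
  have hinj : Function.Injective
      (fun S : Finset 𝔛 => ∑ x ∈ S, ((2 : ℝ) ^ e x)) := by
    intro S T h
    have h2 : ∑ x ∈ S, 2 ^ e x = ∑ x ∈ T, 2 ^ e x := by
      have h' : ∑ x ∈ S, ((2 : ℝ) ^ e x) = ∑ x ∈ T, ((2 : ℝ) ^ e x) := h
      exact_mod_cast h'
    apply Finset.map_injective ⟨e, he⟩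
    apply Finset.geomSum_injective (le_refl 2)
    simpa [Finset.sum_map] using h2
  exact ⟨fun x => 2 ^ e x, Function.extend _ f 0, fun S => (hinj.extend_apply f 0 S).symm⟩
end

section
/- Let M be a positive natural number and let Θ be a real M × M matrix. Then Θ commutes with every M × M permutation matrix (i.e., Θ P = P Θ for every permutation matrix P) if and only if there exist real numbers λ and γ such that Θ = λ I + γ 𝟏𝟏ᵀ, where I is the M × M identity matrix and 𝟏𝟏ᵀ is the M × M matrix all of whose entries equal 1. -/
lemma comm_perm_entry {M : ℕ} (Θ : Matrix (Fin M) (Fin M) ℝ) (π : Equiv.Perm (Fin M)) :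
    (Θ * (Matrix.of fun i j => if i = π j then (1 : ℝ) else 0) =
          (Matrix.of fun i j => if i = π j then (1 : ℝ) else 0) * Θ) ↔
      ∀ i j, Θ (π i) (π j) = Θ i j := by
  have hL : ∀ i j, (Θ * (Matrix.of fun i j => if i = π j then (1 : ℝ) else 0)) i j
      = Θ i (π j) := by
    intro i j
    simp [Matrix.mul_apply]
  have hR : ∀ i j, ((Matrix.of fun i j => if i = π j then (1 : ℝ) else 0) * Θ) (π i) j
      = Θ i j := by
    intro i j
    simp [Matrix.mul_apply]
  constructor
  · intro h i j
    rw [← hL, h, hR]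
  · intro h
    ext i j
    obtain ⟨k, rfl⟩ := π.surjective i
    rw [hL, hR, h]

lemma exists_perm_pair {M : ℕ} {a b i j : Fin M} (hab : a ≠ b) (hij : i ≠ j) :
    ∃ π : Equiv.Perm (Fin M), π a = i ∧ π b = j := by
  refine ⟨Equiv.swap (Equiv.swap a i b) j * Equiv.swap a i, ?_, ?_⟩
  · have h : i ≠ Equiv.swap a i b := by
      intro h
      apply hab
      apply (Equiv.swap a i).injective
      rw [← h, Equiv.swap_apply_left]
    rw [Equiv.Perm.mul_apply, Equiv.swap_apply_left, Equiv.swap_apply_of_ne_of_ne h hij]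
  · rw [Equiv.Perm.mul_apply, Equiv.swap_apply_left]

/-- **DeepSets, Lemma 3 (matrix core).** A real `M × M` matrix commutes with every
permutation matrix iff it is of the form `λ I + γ 𝟏𝟏ᵀ`. -/
theorem commutes_with_perm_matrices_iff {M : ℕ} (hM : 0 < M)
    (Θ : Matrix (Fin M) (Fin M) ℝ) :
    (∀ π : Equiv.Perm (Fin M),
        Θ * (Matrix.of fun i j => if i = π j then (1 : ℝ) else 0) =
          (Matrix.of fun i j => if i = π j then (1 : ℝ) else 0) * Θ) ↔
      ∃ lam gam : ℝ,
        Θ = lam • (1 : Matrix (Fin M) (Fin M) ℝ) +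
          gam • (Matrix.of fun _ _ => (1 : ℝ)) := by
  simp only [comm_perm_entry]
  constructor
  · intro h
    have hd : ∀ i, Θ i i = Θ ⟨0, hM⟩ ⟨0, hM⟩ := by
      intro i
      have := h (Equiv.swap ⟨0, hM⟩ i) ⟨0, hM⟩ ⟨0, hM⟩
      rwa [Equiv.swap_apply_left] at this
    have ho : ∃ g : ℝ, ∀ i j, i ≠ j → Θ i j = g := by
      by_cases hex : ∃ a b : Fin M, a ≠ b
      · obtain ⟨a, b, hab⟩ := hex
        refine ⟨Θ a b, fun i j hij => ?_⟩
        obtain ⟨π, rfl, rfl⟩ := exists_perm_pair hab hij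
        exact h π a b
      · exact ⟨0, fun i j hij => absurd ⟨i, j, hij⟩ hex⟩
    obtain ⟨g, hg⟩ := ho
    refine ⟨Θ ⟨0, hM⟩ ⟨0, hM⟩ - g, g, ?_⟩
    ext i j
    by_cases hij : i = j
    · subst hij
      simp [hd i]
    · simp [hg i j hij, hij]
  · rintro ⟨l, g, rfl⟩ π i j
    simp [Matrix.one_apply]
end

section
/- Let M be a positive natural number, let Θ be a real M × M matrix, and let σ : ℝ → ℝ be an injective function. Define f_Θ : ℝ^M → ℝ^M by applying σ coordinatewise to Θ x, i.e., f_Θ(x)_i = σ((Θ x)_i). Then f_Θ is permutation equivariant — meaning f_Θ(P x) = P f_Θ(x) for every M × M permutation matrix P and every x ∈ ℝ^M — if and only if Θ P = P Θ for every M × M permutation matrix P. -/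
theorem perm_mulVec_aux {M : ℕ} (π : Equiv.Perm (Fin M)) (y : Fin M → ℝ) :
    (Matrix.of fun i j => if i = π j then (1 : ℝ) else 0).mulVec y =
      fun i => y (π.symm i) := by
  ext i
  simp only [Matrix.mulVec, dotProduct, Matrix.of_apply, ← Equiv.symm_apply_eq]
  simp

/-- **DeepSets, Lemma 3 (reduction step).** For injective `σ`, the layer
`x ↦ σ.(Θ x)` is permutation equivariant iff `Θ` commutes with every permutation
matrix. -/
theorem layer_equivariant_iff_commutes {M : ℕ} (hM : 0 < M)
    (Θ : Matrix (Fin M) (Fin M) ℝ) (σ : ℝ → ℝ) (hσ : Function.Injective σ) :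
    (∀ (π : Equiv.Perm (Fin M)) (x : Fin M → ℝ),
        (fun i => σ ((Θ.mulVec
            ((Matrix.of fun i j => if i = π j then (1 : ℝ) else 0).mulVec x)) i)) =
          (Matrix.of fun i j => if i = π j then (1 : ℝ) else 0).mulVec
            (fun i => σ ((Θ.mulVec x) i))) ↔
      ∀ π : Equiv.Perm (Fin M),
        Θ * (Matrix.of fun i j => if i = π j then (1 : ℝ) else 0) =
          (Matrix.of fun i j => if i = π j then (1 : ℝ) else 0) * Θ := by
  constructor
  · intro h π
    apply Matrix.ext_of_mulVec_single
    intro k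
    rw [← Matrix.mulVec_mulVec, ← Matrix.mulVec_mulVec]
    have h1 := h π (Pi.single k 1)
    rw [perm_mulVec_aux π (fun i => σ _)] at h1
    rw [perm_mulVec_aux π (Θ.mulVec _)]
    funext i
    exact hσ (congrFun h1 i)
  · intro h π x
    rw [Matrix.mulVec_mulVec, h π, ← Matrix.mulVec_mulVec, perm_mulVec_aux π (Θ.mulVec _),
      perm_mulVec_aux π (fun i => σ _)]
end

section
/- Let M be a positive natural number and define φ : ℝ → ℝ^{M+1} by φ(t) = (1, t, t², …, t^M). A continuous function f : [0,1]^M → ℝ is permutation invariant if and only if there exists a continuous function ρ : ℝ^{M+1} → ℝ such that f(x_1, …, x_M) = ρ(∑_{m=1}^M φ(x_m)) for all (x_1, …, x_M) ∈ [0,1]^M. -/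
theorem esymm_eq {M : ℕ} (x y : Fin M → ℝ) (h : ∀ k ≤ M, ∑ m, x m ^ k = ∑ m, y m ^ k) (k : ℕ) (hk : k ≤ M) :
   MvPolynomial.aeval x (MvPolynomial.esymm (Fin M) ℝ k) = MvPolynomial.aeval y (MvPolynomial.esymm (Fin M) ℝ k) := by
  induction k using Nat.strong_induction_on with
  | _ k ih =>
  rcases Nat.eq_zero_or_pos k with rfl | hk0
  · simp
  have e := MvPolynomial.mul_esymm_eq_sum (Fin M) ℝ k
  have ex := congrArg (MvPolynomial.aeval x) e
  have ey := congrArg (MvPolynomial.aeval y) e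
  have hk' : (k : ℝ) ≠ 0 := by positivity
  apply mul_left_cancel₀ hk'
  simp only [map_mul, map_natCast, map_sum, map_pow, map_neg, map_one, MvPolynomial.psum, MvPolynomial.aeval_X] at ex ey
  rw [ex, ey]
  congr 1
  refine Finset.sum_congr rfl fun a ha => ?_
  have ha1 := (Finset.mem_filter.mp ha).2
  have ha2 := Finset.HasAntidiagonal.mem_antidiagonal.mp (Finset.mem_filter.mp ha).1
  rw [ih a.1 ha1 (by omega), h a.2 (by omega)]

theorem ms_eq {M : ℕ} (x y : Fin M → ℝ) (h : ∀ k ≤ M, ∑ m, x m ^ k = ∑ m, y m ^ k) :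
    Multiset.map x Finset.univ.val = Multiset.map y Finset.univ.val := by
  have key : (Multiset.map (fun t => Polynomial.X - Polynomial.C t) (Multiset.map x Finset.univ.val)).prod = (Multiset.map (fun t => Polynomial.X - Polynomial.C t) (Multiset.map y Finset.univ.val)).prod := by
    rw [Multiset.prod_X_sub_X_eq_sum_esymm, Multiset.prod_X_sub_X_eq_sum_esymm]
    simp only [Multiset.card_map, Finset.card_val, Finset.card_univ, Fintype.card_fin]
    refine Finset.sum_congr rfl fun j hj => ?_
    have := esymm_eq x y h j (by simp at hj; omega)
    rw [MvPolynomial.aeval_esymm_eq_multiset_esymm, MvPolynomial.aeval_esymm_eq_multiset_esymm] at this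
    rw [this]
  have := congrArg Polynomial.roots key
  rwa [Polynomial.roots_multiset_prod_X_sub_C, Polynomial.roots_multiset_prod_X_sub_C] at this

theorem perm_ex {M : ℕ} (x y : Fin M → ℝ)
    (h : Multiset.map x Finset.univ.val = Multiset.map y Finset.univ.val) :
    ∃ π : Equiv.Perm (Fin M), x ∘ π = y := by
  rw [Fin.univ_val_map, Fin.univ_val_map, Multiset.coe_eq_coe] at h
  have key : x ∘ Tuple.sort x = y ∘ Tuple.sort y := by
    apply List.ofFn_injective
    refine List.Perm.eq_of_pairwise' (Tuple.monotone_sort x).sortedLE_ofFn.pairwise (Tuple.monotone_sort y).sortedLE_ofFn.pairwise ?_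
    exact ((Tuple.sort x).ofFn_comp_perm x).trans (h.trans ((Tuple.sort y).ofFn_comp_perm y).symm)
  refine ⟨(Tuple.sort y).symm.trans (Tuple.sort x), ?_⟩
  funext i
  have := congrFun key ((Tuple.sort y).symm i)
  simpa using this

/-- **DeepSets, Theorem 7.** A continuous function `f : [0,1]^M → ℝ` is permutation
invariant iff `f(x) = ρ(∑ₘ φ(xₘ))` for a continuous `ρ : ℝ^{M+1} → ℝ`, where
`φ(t) = (1, t, t², …, t^M)`. -/
theorem continuous_perm_invariant_iff_sum_decomposition {M : ℕ} (hM : 0 < M)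
    (f : (Fin M → ℝ) → ℝ)
    (hf : ContinuousOn f {x : Fin M → ℝ | ∀ i, x i ∈ Set.Icc (0 : ℝ) 1}) :
    (∀ x : Fin M → ℝ, (∀ i, x i ∈ Set.Icc (0 : ℝ) 1) →
        ∀ π : Equiv.Perm (Fin M), f (x ∘ π) = f x) ↔
      ∃ ρ : (Fin (M + 1) → ℝ) → ℝ, Continuous ρ ∧
        ∀ x : Fin M → ℝ, (∀ i, x i ∈ Set.Icc (0 : ℝ) 1) →
          f x = ρ (∑ m, fun q : Fin (M + 1) => (x m) ^ (q : ℕ)) := by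
  constructor
  · intro hinv
    set K : Set (Fin M → ℝ) := {x : Fin M → ℝ | ∀ i, x i ∈ Set.Icc (0 : ℝ) 1} with hK
    have hKc : IsCompact K := by
      have : K = Set.univ.pi fun _ => Set.Icc (0 : ℝ) 1 := by ext; simp only [hK, Set.mem_pi, Set.mem_univ, forall_true_left, Set.mem_ofPred_eq]
      rw [this]
      exact isCompact_univ_pi fun _ => isCompact_Icc
    have : CompactSpace K := isCompact_iff_compactSpace.mp hKc
    let E : K → (Fin (M + 1) → ℝ) := fun x => ∑ m, fun q : Fin (M + 1) => (x.1 m) ^ (q : ℕ)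
    have hE : Continuous E := 
      continuous_finsetSum _ fun m _ => continuous_pi fun q =>
        ((continuous_apply m).comp continuous_subtype_val).pow _
    let g : C(K, Set.range E) := ⟨Set.rangeFactorization E, hE.subtype_mk _⟩
    have hq : Topology.IsQuotientMap g :=
      g.continuous.isClosedMap.isQuotientMap g.continuous Set.rangeFactorization_surjective
    let F : C(K, ℝ) := ⟨fun x => f x.1, continuousOn_iff_continuous_domRestrict.mp hf⟩
    have hF : Function.FactorsThrough F g := by
      intro x y hxy
      have hxy' : E x = E y := congrArg Subtype.val hxy
      have hs : ∀ k ≤ M, ∑ m, x.1 m ^ k = ∑ m, y.1 m ^ k := by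
        intro k hk
        have := congrFun hxy' ⟨k, by omega⟩
        simpa [E, Finset.sum_apply] using this
      obtain ⟨π, hπ⟩ := perm_ex _ _ (ms_eq _ _ hs)
      change f x.1 = f y.1
      rw [← hπ, hinv x.1 x.2]
    obtain ⟨ρ, hρ⟩ := ContinuousMap.exists_restrict_eq (isCompact_range hE).isClosed (hq.lift F hF)
    refine ⟨ρ, ρ.continuous, fun x hx => ?_⟩
    have h1 := congrArg (fun G : C(Set.range E, ℝ) => G (g ⟨x, hx⟩)) hρ
    have h2 := congrArg (fun G : C(K, ℝ) => G ⟨x, hx⟩) (hq.lift_comp F hF)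
    exact (h1.trans h2).symm
  · rintro ⟨ρ, -, h⟩ x hx π
    rw [h x hx, h (x ∘ π) fun i => hx (π i)]
    congr 1
    exact Equiv.sum_comp π fun m => fun q : Fin (M + 1) => (x m) ^ (q : ℕ)
end

section
/- Let M and d be positive natural numbers, let K ⊆ ℝ^d be a compact set, and let f : K^M → ℝ be a continuous function that is permutation invariant. Then for every ε > 0 there exist a natural number D, a continuous function φ : ℝ^d → ℝ^D, and a continuous function ρ : ℝ^D → ℝ such that |f(x_1, …, x_M) − ρ(∑_{m=1}^M φ(x_m))| ≤ ε for all (x_1, …, x_M) ∈ K^M. -/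
open Classical in
theorem exists_perm_of_sums {M d : ℕ} (x y : Fin M → (Fin d → ℝ))
    (h : ∀ ψ : C(Fin d → ℝ, ℝ), ∑ m, ψ (x m) = ∑ m, ψ (y m)) :
    ∃ π : Equiv.Perm (Fin M), y = x ∘ π := by
  have hc : ∀ p, Fintype.card {m // y m = p} = Fintype.card {m // x m = p} := by
    intro p
    let S : Set (Fin d → ℝ) := (Set.range x ∪ Set.range y) \ {p}
    have hS : S.Finite := ((Set.finite_range x).union (Set.finite_range y)).subset Set.sdiff_subset
    obtain ⟨ψ, h0, h1, -⟩ := exists_continuous_zero_one_of_isClosed hS.isClosed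
      (isClosed_singleton (x := p)) (by simp [S, Set.disjoint_left])
    have e : ∀ z : Fin M → (Fin d → ℝ), Set.range z ⊆ Set.range x ∪ Set.range y →
        ∑ m, ψ (z m) = (Fintype.card {m // z m = p} : ℝ) := by
      intro z hz
      rw [Fintype.card_subtype, Finset.card_filter]
      push_cast
      refine Finset.sum_congr rfl fun m _ => ?_
      split_ifs with hm
      · rw [hm]; exact h1 rfl
      · exact h0 ⟨hz ⟨m, rfl⟩, hm⟩
    have := h ψ
    rw [e x Set.subset_union_left, e y Set.subset_union_right] at this
    exact_mod_cast this.symm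
  refine ⟨Equiv.ofFiberEquiv (f := y) (g := x) fun p => Fintype.equivOfCardEq (hc p), ?_⟩
  funext m
  exact (Equiv.ofFiberEquiv_map _ m).symm

/-- Points with equal sums against every continuous test function. -/
def sumSetoid {M d : ℕ} (K : Set (Fin d → ℝ)) :
    Setoid {x : Fin M → (Fin d → ℝ) // ∀ m, x m ∈ K} where
  r x y := ∀ ψ : C(Fin d → ℝ, ℝ), ∑ m, ψ (x.1 m) = ∑ m, ψ (y.1 m)
  iseqv := ⟨fun _ _ => rfl, fun h ψ => (h ψ).symm, fun h h' ψ => (h ψ).trans (h' ψ)⟩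

/-- Sum-decomposable functions, as a subalgebra. -/
def sumAlg {M d : ℕ} (K : Set (Fin d → ℝ)) :
    Subalgebra ℝ C(Quotient (sumSetoid (M := M) K), ℝ) where
  carrier := {g | ∃ (ι : Type) (_ : Fintype ι) (φ : (Fin d → ℝ) → (ι → ℝ)) (ρ : (ι → ℝ) → ℝ),
    Continuous φ ∧ Continuous ρ ∧
      ∀ x : {x : Fin M → (Fin d → ℝ) // ∀ m, x m ∈ K}, g ⟦x⟧ = ρ (∑ m, φ (x.1 m))}
  algebraMap_mem' r := ⟨Empty, inferInstance, fun _ _ => 0, fun _ => r, by fun_prop, by fun_prop,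
    fun x => rfl⟩
  add_mem' := by
    rintro a b ⟨ι, _, φ, ρ, hφ, hρ, h⟩ ⟨κ, _, φ', ρ', hφ', hρ', h'⟩
    refine ⟨ι ⊕ κ, inferInstance, fun t => Sum.elim (φ t) (φ' t),
      fun z => ρ (fun i => z (Sum.inl i)) + ρ' (fun i => z (Sum.inr i)), ?_, by fun_prop, ?_⟩
    · refine continuous_pi ?_
      rintro (i | i) <;> simp only [Sum.elim_inl, Sum.elim_inr] <;> fun_prop
    · intro x
      rw [ContinuousMap.add_apply, h, h']
      congr 2 <;> (funext i; simp)
  mul_mem' := by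
    rintro a b ⟨ι, _, φ, ρ, hφ, hρ, h⟩ ⟨κ, _, φ', ρ', hφ', hρ', h'⟩
    refine ⟨ι ⊕ κ, inferInstance, fun t => Sum.elim (φ t) (φ' t),
      fun z => ρ (fun i => z (Sum.inl i)) * ρ' (fun i => z (Sum.inr i)), ?_, by fun_prop, ?_⟩
    · refine continuous_pi ?_
      rintro (i | i) <;> simp only [Sum.elim_inl, Sum.elim_inr] <;> fun_prop
    · intro x
      rw [ContinuousMap.mul_apply, h, h']
      congr 2 <;> (funext i; simp)

theorem sumAlg_separates {M d : ℕ} (K : Set (Fin d → ℝ)) :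
    (sumAlg (M := M) K).SeparatesPoints := by
  intro p q
  induction p using Quotient.inductionOn with | _ x => ?_
  induction q using Quotient.inductionOn with | _ y => ?_
  intro hne
  have : ¬ ∀ ψ : C(Fin d → ℝ, ℝ), ∑ m, ψ (x.1 m) = ∑ m, ψ (y.1 m) :=
    fun h => hne (Quotient.sound h)
  push Not at this
  obtain ⟨ψ, hψ⟩ := this
  let g : C(Quotient (sumSetoid (M := M) K), ℝ) :=
    ⟨Quotient.lift (fun x => ∑ m, ψ (x.1 m)) (fun a b h => h ψ),
      Continuous.quotient_lift (continuous_finsetSum _ fun m _ =>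
        ψ.continuous.comp ((continuous_apply m).comp continuous_subtype_val)) _⟩
  refine ⟨g, ⟨g, ⟨Unit, inferInstance, fun t _ => ψ t, fun z => z (), by fun_prop, by fun_prop,
    fun x => ?_⟩, rfl⟩, hψ⟩
  simp [g]

/-- **DeepSets, Theorem 9.** A continuous permutation-invariant function of `M`
points from a compact `K ⊆ ℝ^d` can be uniformly approximated by functions of the
form `ρ(∑ₘ φ(xₘ))`. -/
theorem perm_invariant_approx_sum_decomposition {M d : ℕ} (hM : 0 < M) (hd : 0 < d)
    (K : Set (Fin d → ℝ)) (hK : IsCompact K)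
    (f : (Fin M → (Fin d → ℝ)) → ℝ)
    (hf : ContinuousOn f {x | ∀ m, x m ∈ K})
    (hsym : ∀ x : Fin M → (Fin d → ℝ), (∀ m, x m ∈ K) →
      ∀ π : Equiv.Perm (Fin M), f (x ∘ π) = f x) :
    ∀ ε : ℝ, 0 < ε →
      ∃ (D : ℕ) (φ : (Fin d → ℝ) → (Fin D → ℝ)) (ρ : (Fin D → ℝ) → ℝ),
        Continuous φ ∧ Continuous ρ ∧
          ∀ x : Fin M → (Fin d → ℝ), (∀ m, x m ∈ K) →
            |f x - ρ (∑ m, φ (x m))| ≤ ε := by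
  intro ε hε
  have hcs : CompactSpace {x : Fin M → (Fin d → ℝ) // ∀ m, x m ∈ K} := by
    exact isCompact_iff_compactSpace.mp (isCompact_pi_infinite fun _ : Fin M => hK)
  let F : C(Quotient (sumSetoid (M := M) K), ℝ) :=
    ⟨Quotient.lift (fun x => f x.1) (fun a b h => by
        obtain ⟨π, hπ⟩ := exists_perm_of_sums a.1 b.1 h
        rw [hπ, hsym a.1 a.2 π]),
      Continuous.quotient_lift (continuousOn_iff_continuous_domRestrict.mp hf) _⟩
  obtain ⟨⟨g, ι, _, φ, ρ, hφ, hρ, h⟩, hg⟩ :=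
    ContinuousMap.exists_mem_subalgebra_near_continuousMap_of_separatesPoints
      (sumAlg (M := M) K) (sumAlg_separates K) F ε hε
  let e := Fintype.equivFin ι
  refine ⟨Fintype.card ι, fun t i => φ t (e.symm i), fun z => ρ (fun i => z (e i)),
    by fun_prop, by fun_prop, fun x hx => ?_⟩
  have h1 := (g - F).norm_coe_le_norm (Quotient.mk _ ⟨x, hx⟩)
  have h2 : (g - F) (Quotient.mk _ ⟨x, hx⟩) = ρ (∑ m, φ (x m)) - f x := by
    rw [ContinuousMap.sub_apply, h]; rfl
  have h3 : (fun i => (∑ m, fun i => φ (x m) (e.symm i)) (e i)) = ∑ m, φ (x m) := by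
    funext i; simp
  rw [h2, Real.norm_eq_abs] at h1
  rw [abs_sub_comm]
  simp only [h3]
  exact h1.trans hg.le
end

section
/- Let M, D, D' be positive natural numbers, let Λ, Γ be real D × D' matrices, and let σ : ℝ → ℝ be any function. Define f on real M × D matrices by f(x) = σ applied entrywise to (x Λ − 𝟏𝟏ᵀ x Γ), where 𝟏𝟏ᵀ is the M × M matrix all of whose entries equal 1. Then for every M × M permutation matrix P and every real M × D matrix x, f(P x) = P f(x). -/
/-- **Multi-channel permutation-equivariant layer.** For the layer
`f(x) = σ.(x Λ − 𝟏𝟏ᵀ x Γ)` acting on `M × D` matrices, permuting the rows of the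
input permutes the rows of the output. -/
theorem multichannel_layer_equivariant {M D D' : ℕ}
    (hM : 0 < M) (hD : 0 < D) (hD' : 0 < D')
    (Λ Γ : Matrix (Fin D) (Fin D') ℝ) (σ : ℝ → ℝ) :
    ∀ (π : Equiv.Perm (Fin M)) (x : Matrix (Fin M) (Fin D) ℝ),
      ((((Matrix.of fun i j => if i = π j then (1 : ℝ) else 0) * x) * Λ -
          (Matrix.of fun _ _ => (1 : ℝ) : Matrix (Fin M) (Fin M) ℝ) *
            ((Matrix.of fun i j => if i = π j then (1 : ℝ) else 0) * x) * Γ).map σ) =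
        (Matrix.of fun i j => if i = π j then (1 : ℝ) else 0) *
          ((x * Λ - (Matrix.of fun _ _ => (1 : ℝ) : Matrix (Fin M) (Fin M) ℝ) * x * Γ).map σ) := by
  intro π x
  have key : ∀ {K : ℕ} (y : Matrix (Fin M) (Fin K) ℝ),
      (Matrix.of fun i j => if i = π j then (1 : ℝ) else 0) * y
        = Matrix.of fun i k => y (π.symm i) k := by
    intro K y
    ext i k
    simp [Matrix.mul_apply, ← Equiv.symm_apply_eq]
  rw [key, key]
  ext i k
  have hsum : ∀ d, ∑ j, x (π.symm j) d = ∑ j, x j d := fun d =>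
    Equiv.sum_comp π.symm (fun j => x j d)
  simp [Matrix.mul_apply, hsum]
end
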